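/- Let F : ℝ → ℝ be a function with sup|F| ≤ M, let Ω := {(x,y) ∈ ℝ² : y < F(x)}, let c_* > 0, a ∈ (0,1], and let u : ℝ² → [0,∞) be continuous with {u > 0} = Ω, u harmonic (C² with Δu = 0) in Ω, |u(x,y) + c_* y| ≤ c_* M in Ω, and ∂_y u ≤ −a c_* in Ω. Then for any θ₀ ∈ (π/4, π/2) there exist r₀ ≥ 1 and c₂ > 0, depending only on θ₀, a and M but not on c_*, such that for every r ≥ r₀ and every point (x,y) ∈ Ω with dist((x,y), ∂Ω) ≥ r: (i) ∇_e u(x,y) ≥ 0 for every direction e ∈ W_{θ₀,−e₂}; and (ii) for every ν ∈ W_{θ₀/2,−e₂} with 0 < |ν| < 1/8, sup_{z ∈ B_{(1+c₂η_ν)δ_ν}((x,y))} u(z − ν) ≤ u(x,y) − c_* η_ν |ν|, where η_ν := (a/4) cos(⟨−e₂,ν⟩ + θ₀/2) and δ_ν := |ν| sin(θ₀/2). -/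

import Mathlib

open Set Metric Real InnerProductGeometry

noncomputable section

abbrev Euc2 := EuclideanSpace ℝ (Fin 2)

/-- The Laplacian in ℝ², as the trace of the second derivative. -/
def lap (f : Euc2 → ℝ) (x : Euc2) : ℝ :=
  ∑ i : Fin 2, fderiv ℝ (fun y => fderiv ℝ f y (EuclideanSpace.single i 1)) x
      (EuclideanSpace.single i 1)

/-- The cone W_{θ,μ} of vectors making angle at most θ with μ (together with 0). -/
def cone (θ : ℝ) (μ : Euc2) : Set Euc2 := {p | p = 0 ∨ angle p μ ≤ θ}

/-- e₂ = (0,1). -/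
def e2 : Euc2 := EuclideanSpace.single 1 1

open InnerProductSpace in
/-- The Laplacian commutes with precomposition by a linear isometry. -/
theorem laplacian_comp_linearIsometryEquiv {E E' G : Type*}
    [NormedAddCommGroup E] [InnerProductSpace ℝ E] [FiniteDimensional ℝ E]
    [NormedAddCommGroup E'] [InnerProductSpace ℝ E'] [FiniteDimensional ℝ E']
    [NormedAddCommGroup G] [NormedSpace ℝ G] (f : E' → G) (φ : E ≃ₗᵢ[ℝ] E') :
    Laplacian.laplacian (f ∘ φ) = Laplacian.laplacian f ∘ φ := by
  ext x
  rw [laplacian_eq_iteratedFDeriv_stdOrthonormalBasis,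
    laplacian_eq_iteratedFDeriv_orthonormalBasis f ((stdOrthonormalBasis ℝ E).map φ)]
  have h := φ.toContinuousLinearEquiv.iteratedFDerivWithin_comp_right f uniqueDiffOn_univ
    (mem_univ (φ x)) 2
  rw [preimage_univ, iteratedFDerivWithin_univ, iteratedFDerivWithin_univ] at h
  refine Finset.sum_congr rfl fun i _ => ?_
  have h' := congrArg (fun L => L ![stdOrthonormalBasis ℝ E i, stdOrthonormalBasis ℝ E i]) h
  refine h'.trans ?_
  rw [ContinuousMultilinearMap.compContinuousLinearMap_apply]
  refine congrArg (iteratedFDeriv ℝ 2 f (φ x)) ?_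
  ext j
  fin_cases j <;> simp

/-- `lap` is Mathlib's Laplacian at points where the function is twice differentiable. -/
theorem lap_eq_laplacian {f : Euc2 → ℝ} {x : Euc2} (hf : ContDiffAt ℝ 2 f x) :
    Laplacian.laplacian f x = lap f x := by
  rw [InnerProductSpace.laplacian_eq_iteratedFDeriv_orthonormalBasis f
    (EuclideanSpace.basisFun (Fin 2) ℝ)]
  have hd : DifferentiableAt ℝ (fderiv ℝ f) x :=
    (hf.fderiv_right (m := 1) (by norm_num)).differentiableAt one_ne_zero
  refine Finset.sum_congr rfl fun i _ => ?_
  rw [iteratedFDeriv_two_apply, fderiv_clm_apply hd (by fun_prop)]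
  simp

/-- Interior gradient estimate for a bounded harmonic function in the plane. -/
theorem norm_fderiv_le_of_harmonicOnNhd {f : ℂ → ℝ} {z : ℂ} {R K : ℝ} (hR : 0 < R) (hK : 0 < K)
    (hf : InnerProductSpace.HarmonicOnNhd f (ball z R)) (hb : ∀ x ∈ ball z R, |f x| ≤ K) :
    ‖fderiv ℝ f z‖ ≤ 16 * K / R := by
  obtain ⟨G, hG, hre⟩ := hf.exists_analyticOnNhd_ball_re_eq
  have hz : z ∈ ball z R := mem_ball_self hR
  have hsub : closedBall z (R / 2) ⊆ ball z R := closedBall_subset_ball (by linarith)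
  have hGd : HasDerivAt G (deriv G z) z := (hG z hz).differentiableAt.hasDerivAt
  have hexp : ‖deriv (fun x => Complex.exp (G x / K)) z‖ ≤ Real.exp 1 / (R / 2) := by
    refine Complex.norm_deriv_le_of_forall_mem_sphere_norm_le (by positivity) ?_ ?_
    · refine DifferentiableOn.diffContOnCl_ball (U := ball z R) ?_ hsub
      exact (hG.differentiableOn.div_const _).cexp
    · intro x hx
      have hx' := hsub (sphere_subset_closedBall hx)
      rw [Complex.norm_exp, Complex.div_ofReal_re, Real.exp_le_exp, div_le_one hK]
      exact (hre hx').trans_le ((le_abs_self _).trans (hb x hx'))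
  rw [((hGd.div_const (K : ℂ)).cexp).deriv, norm_mul, Complex.norm_exp, Complex.div_ofReal_re,
    norm_div, Complex.norm_real, Real.norm_of_nonneg hK.le] at hexp
  have hlow : Real.exp (-1) ≤ Real.exp ((G z).re / K) := by
    rw [Real.exp_le_exp, le_div_iff₀ hK]
    have := neg_abs_le (f z)
    have := hb z hz
    have := hre hz
    simp only at this
    linarith
  have hderiv : ‖deriv G z‖ ≤ 16 * K / R := by
    have h1 : Real.exp (-1) * (‖deriv G z‖ / K) ≤ Real.exp 1 / (R / 2) :=
      (mul_le_mul_of_nonneg_right hlow (by positivity)).trans hexp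
    have h2 : ‖deriv G z‖ / K ≤ Real.exp 1 * (Real.exp 1 / (R / 2)) := by
      have := mul_le_mul_of_nonneg_left h1 (Real.exp_pos 1).le
      rwa [← mul_assoc, ← Real.exp_add, add_neg_cancel, Real.exp_zero, one_mul] at this
    have he : Real.exp 1 * Real.exp 1 ≤ 8 := by
      have := Real.exp_one_lt_d9
      have := Real.exp_pos 1
      nlinarith
    rw [div_le_iff₀ hK] at h2
    refine h2.trans ?_
    have h3 : Real.exp 1 * (Real.exp 1 / (R / 2)) * K
        = (Real.exp 1 * Real.exp 1) * (2 * K / R) := by field_simp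
    have h4 : 16 * K / R = 8 * (2 * K / R) := by ring
    rw [h3, h4]
    gcongr
  have hfd : HasFDerivAt f (Complex.reCLM.comp
      ((ContinuousLinearMap.toSpanSingleton ℂ (deriv G z)).restrictScalars ℝ)) z := by
    refine HasFDerivAt.congr_of_eventuallyEq
      (Complex.reCLM.hasFDerivAt.comp z (hGd.hasFDerivAt.restrictScalars ℝ)) ?_
    filter_upwards [isOpen_ball.mem_nhds hz] with x hx using (hre hx).symm
  rw [hfd.fderiv]
  refine ContinuousLinearMap.opNorm_le_bound _ (by positivity) fun w => ?_
  calc _ = |(w * deriv G z).re| := by simp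
    _ ≤ ‖w * deriv G z‖ := Complex.abs_re_le_norm _
    _ = ‖deriv G z‖ * ‖w‖ := by rw [norm_mul, mul_comm]
    _ ≤ 16 * K / R * ‖w‖ := by gcongr

/-- The second coordinate as a continuous linear functional. -/
abbrev yCoord : Euc2 →L[ℝ] ℝ := EuclideanSpace.proj 1

/-- A harmonic function within `c * N` of `-c y` has gradient close to that of `-c y`. -/
theorem norm_fderiv_add_smul_yCoord_le {u : Euc2 → ℝ} {z : Euc2} {R c N : ℝ} (hR : 0 < R)
    (hc : 0 < c) (hN : 0 < N) (hu : ContDiffOn ℝ 2 u (ball z R))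
    (hlap : ∀ x ∈ ball z R, lap u x = 0) (hb : ∀ x ∈ ball z R, |u x + c * x 1| ≤ c * N) :
    ‖fderiv ℝ u z - -(c • yCoord)‖ ≤ 16 * (c * N) / R := by
  set φ : ℂ ≃ₗᵢ[ℝ] Euc2 := Complex.orthonormalBasisOneI.repr with hφ
  set w : ℂ := φ.symm z with hw
  have hφw : φ w = z := φ.apply_symm_apply z
  have hmem : ∀ x ∈ ball w R, φ x ∈ ball z R := fun x hx => by
    rw [mem_ball, ← hφw, φ.dist_map]; exact hx
  have hcda : ∀ x ∈ ball z R, ContDiffAt ℝ 2 u x := fun x hx =>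
    hu.contDiffAt (isOpen_ball.mem_nhds hx)
  have h1 : InnerProductSpace.HarmonicOnNhd (u ∘ φ) (ball w R) := fun x hx => by
    refine ⟨(hcda _ (hmem x hx)).comp x φ.toContinuousLinearEquiv.contDiff.contDiffAt, ?_⟩
    filter_upwards [isOpen_ball.mem_nhds hx] with y hy
    rw [laplacian_comp_linearIsometryEquiv]
    exact (lap_eq_laplacian (hcda _ (hmem y hy))).trans (hlap _ (hmem y hy))
  have h2 : InnerProductSpace.HarmonicOnNhd (fun x : ℂ => x.im) (ball w R) :=
    fun x _ => analyticAt_id.harmonicAt_im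
  have h3 := h1.add (h2.const_smul (c := c))
  have h4 := norm_fderiv_le_of_harmonicOnNhd hR (mul_pos hc hN) h3 fun x hx => by
    simpa [hφ] using hb _ (hmem x hx)
  have hz : z ∈ ball z R := mem_ball_self hR
  have hfd : HasFDerivAt (u ∘ φ + c • fun x : ℂ => x.im)
      ((fderiv ℝ u z - -(c • yCoord)).comp (φ.toContinuousLinearEquiv : ℂ →L[ℝ] Euc2)) w := by
    have hu' : HasFDerivAt (fun x => u x + c * yCoord x) (fderiv ℝ u z - -(c • yCoord)) (φ w) := by
      rw [hφw, sub_neg_eq_add]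
      exact ((hcda z hz).differentiableAt two_ne_zero).hasFDerivAt.add
        (yCoord.hasFDerivAt.const_mul c)
    exact hu'.comp w φ.toContinuousLinearEquiv.hasFDerivAt
  rw [hfd.fderiv] at h4
  refine ContinuousLinearMap.opNorm_le_bound _ (by positivity) fun v => ?_
  have := ContinuousLinearMap.le_of_opNorm_le _ h4 (φ.symm v)
  simpa using this

/-- A ball around a point of an open set that stays away from the frontier lies in the set. -/
theorem ball_infDist_frontier_subset {E : Type*} [NormedAddCommGroup E] [NormedSpace ℝ E]
    {s : Set E} (hs : IsOpen s) {z : E} (hz : z ∈ s) :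
    ball z (infDist z (frontier s)) ⊆ s := by
  rcases (infDist_nonneg (x := z) (s := frontier s)).eq_or_lt with h | h
  · simp [← h]
  have hsub : ball z (infDist z (frontier s)) ⊆ s ∪ (closure s)ᶜ := fun w hw => by
    by_contra hcon
    simp only [mem_union, mem_compl_iff, not_or, not_not] at hcon
    exact disjoint_left.1 disjoint_ball_infDist hw (hs.frontier_eq ▸ ⟨hcon.2, hcon.1⟩)
  refine (convex_ball z _).isPreconnected.subset_left_of_subset_union hs
    isClosed_closure.isOpen_compl ?_ hsub ⟨z, mem_ball_self h, hz⟩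
  exact disjoint_compl_right.mono_left subset_closure

theorem three_eighths_mul_cos_add_le {α β : ℝ} (hα : 0 ≤ α) (hαβ : α ≤ β) (hβ : β ≤ π / 4) :
    3 / 8 * Real.cos (α + β) ≤ Real.cos α - Real.sin β := by
  have hπ := Real.pi_pos
  set γ := π / 4 - (α + β) / 2 with hγ
  have hs : Real.sin (π / 8) ≤ Real.sin (π / 4 + (α - β) / 2) :=
    Real.sin_le_sin_of_le_of_le_pi_div_two (by linarith) (by linarith) (by linarith)
  have h8 : 3 / 8 ≤ Real.sin (π / 8) := by
    rw [Real.sin_pi_div_eight]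
    have : (3 / 4 : ℝ) ≤ √(2 - √2) := by
      refine Real.le_sqrt_of_sq_le ?_
      have : √2 ≤ 23 / 16 := by rw [Real.sqrt_le_left (by norm_num)]; norm_num
      linarith
    linarith
  have hγ0 : 0 ≤ Real.sin γ := Real.sin_nonneg_of_nonneg_of_le_pi (by linarith) (by linarith)
  have hcos : Real.cos (α + β) = 2 * Real.sin γ * Real.cos γ := by
    rw [← Real.sin_two_mul, ← Real.cos_pi_div_two_sub]; congr 1; rw [hγ]; ring
  have hdiff : Real.cos α - Real.sin β = 2 * Real.sin (π / 4 + (α - β) / 2) * Real.sin γ := by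
    rw [← Real.cos_pi_div_two_sub, Real.cos_sub_cos,
      show (α + (π / 2 - β)) / 2 = π / 4 + (α - β) / 2 by ring,
      show (α - (π / 2 - β)) / 2 = -γ by rw [hγ]; ring, Real.sin_neg]
    ring
  rw [hcos, hdiff]
  have := Real.cos_le_one γ
  nlinarith [mul_nonneg hγ0 (sub_nonneg.2 this), mul_nonneg hγ0 (sub_nonneg.2 (h8.trans hs))]

theorem norm_mul_cos_angle_neg_e2 (v : Euc2) : ‖v‖ * Real.cos (angle v (-e2)) = -v 1 := by
  have h := cos_angle_mul_norm_mul_norm v (-e2)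
  rw [mul_comm]
  simpa [e2, EuclideanSpace.inner_single_right] using h

/-- Interior gain for the 2D Muskat setting: if `u` is harmonic below the bounded graph
`y = F(x)`, close to `−c_* y`, and satisfies `∂_y u ≤ −a c_*`, then for `θ₀ ∈ (π/4,π/2)`
there are `r₀ ≥ 1`, `c₂ > 0` (independent of `c_*`) such that deep inside the domain `u`
is monotone along `W_{θ₀,−e₂}` and satisfies a quantified sup-convolution gain. -/
theorem interior_gain_muskat (M a : ℝ) (ha : a ∈ Set.Ioc (0 : ℝ) 1)
    (θ₀ : ℝ) (hθ₀ : θ₀ ∈ Set.Ioo (π / 4) (π / 2)) :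
    ∃ r₀ c₂ : ℝ, 1 ≤ r₀ ∧ 0 < c₂ ∧
      ∀ (F : ℝ → ℝ) (cstar : ℝ) (u : Euc2 → ℝ),
        (∀ x, |F x| ≤ M) → 0 < cstar →
        Continuous u → (∀ z, 0 ≤ u z) →
        {z : Euc2 | 0 < u z} = {z : Euc2 | z 1 < F (z 0)} →
        ContDiffOn ℝ 2 u {z : Euc2 | z 1 < F (z 0)} →
        (∀ z ∈ {z : Euc2 | z 1 < F (z 0)}, lap u z = 0) →
        (∀ z ∈ {z : Euc2 | z 1 < F (z 0)}, |u z + cstar * z 1| ≤ cstar * M) →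
        (∀ z ∈ {z : Euc2 | z 1 < F (z 0)}, fderiv ℝ u z e2 ≤ -(a * cstar)) →
        ∀ r : ℝ, r₀ ≤ r →
        ∀ z ∈ {z : Euc2 | z 1 < F (z 0)},
          r ≤ infDist z (frontier {z : Euc2 | z 1 < F (z 0)}) →
          (∀ e ∈ cone θ₀ (-e2), 0 ≤ fderiv ℝ u z e) ∧
          (∀ ν ∈ cone (θ₀ / 2) (-e2), ν ≠ 0 → ‖ν‖ < 1 / 8 →
            ∀ w ∈ ball z
              ((1 + c₂ * ((a / 4) * Real.cos (angle (-e2) ν + θ₀ / 2))) *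
                (‖ν‖ * Real.sin (θ₀ / 2))),
              u (w - ν) ≤ u z - cstar * ((a / 4) * Real.cos (angle (-e2) ν + θ₀ / 2)) * ‖ν‖) := by
  obtain ⟨ha0, ha1⟩ := ha
  obtain ⟨hθl, hθu⟩ := hθ₀
  have hπ := Real.pi_pos
  set D := Real.cos θ₀ with hD
  have hD0 : 0 < D := Real.cos_pos_of_mem_Ioo ⟨by linarith, hθu⟩
  have hD1 : D ≤ 1 := Real.cos_le_one _
  set N := |M| + 1 with hN
  have hN1 : 1 ≤ N := by have := abs_nonneg M; linarith
  have hr0 : 1 ≤ 3200 * N / D := by rw [le_div_iff₀ hD0]; linarith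
  refine ⟨3200 * N / D, 1 / 5, hr0, by norm_num, ?_⟩
  intro F c u _ hc hcont _ hpos hC2 hlap hclose _ r hr z hz hdist
  set Ω := {z : Euc2 | z 1 < F (z 0)} with hΩ
  have hΩo : IsOpen Ω := hpos ▸ isOpen_lt continuous_const hcont
  have hr1 : 1 ≤ r := hr0.trans hr
  have hball : ball z r ⊆ Ω :=
    (ball_subset_ball hdist).trans (ball_infDist_frontier_subset hΩo hz)
  have hgrad : ∀ x ∈ ball z (r / 2), ‖fderiv ℝ u x - -(c • yCoord)‖ ≤ c * (D / 100) := by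
    intro x hx
    have hsub : ball x (r / 2) ⊆ Ω := by
      refine (ball_subset_ball' ?_).trans hball
      rw [mem_ball] at hx
      linarith
    refine (norm_fderiv_add_smul_yCoord_le (N := N) (by positivity) hc (by positivity) (hC2.mono hsub)
      (fun y hy => hlap y (hsub hy)) fun y hy => (hclose y (hsub hy)).trans ?_).trans ?_
    · exact mul_le_mul_of_nonneg_left ((le_abs_self M).trans (lt_add_one _).le) hc.le
    · rw [div_le_iff₀ hD0] at hr
      rw [div_le_iff₀ (by positivity)]
      nlinarith [mul_le_mul_of_nonneg_left hr hc.le]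
  have hzr : z ∈ ball z (r / 2) := mem_ball_self (by positivity)
  refine ⟨?_, ?_⟩
  · rintro e (rfl | he)
    · simp
    have h1 := ContinuousLinearMap.le_of_opNorm_le _ (hgrad z hzr) e
    have h2 : D ≤ Real.cos (angle e (-e2)) :=
      Real.cos_le_cos_of_nonneg_of_le_pi (angle_nonneg _ _) (by linarith) he
    have h3 := norm_mul_cos_angle_neg_e2 e
    have h4 := neg_abs_le ((fderiv ℝ u z - -(c • yCoord)) e)
    rw [← Real.norm_eq_abs] at h4
    have h5 : (fderiv ℝ u z - -(c • yCoord)) e = fderiv ℝ u z e + c * e 1 := by simp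
    rw [h5] at h1 h4
    have h6 : c * (D * ‖e‖) ≤ c * -e 1 := by
      rw [← h3, mul_comm D]; gcongr
    have : 0 ≤ c * (D * ‖e‖) := by positivity
    nlinarith
  · intro ν hν hν0 hν8 w hw
    have hν' : angle ν (-e2) ≤ θ₀ / 2 := hν.resolve_left hν0
    set α := angle (-e2) ν with hα
    have hαβ : α ≤ θ₀ / 2 := by rw [hα, angle_comm]; exact hν'
    have hα0 : 0 ≤ α := angle_nonneg _ _
    have hν1 : ν 1 = -(‖ν‖ * Real.cos α) := by
      rw [hα, angle_comm, norm_mul_cos_angle_neg_e2, neg_neg]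
    set κ := Real.cos (α + θ₀ / 2) with hκ
    have hDκ : D ≤ κ := Real.cos_le_cos_of_nonneg_of_le_pi (by linarith) (by linarith) (by linarith)
    have hκ1 : κ ≤ 1 := Real.cos_le_one _
    have htrig : 3 / 8 * κ ≤ Real.cos α - Real.sin (θ₀ / 2) :=
      three_eighths_mul_cos_add_le hα0 hαβ (by linarith)
    set σ := Real.sin (θ₀ / 2) with hσ
    have hσ0 : 0 ≤ σ := Real.sin_nonneg_of_nonneg_of_le_pi (by linarith) (by linarith)
    have hσ1 : σ ≤ 1 := Real.sin_le_one _
    set η := a / 4 * κ with hη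
    have hη0 : 0 ≤ η := by have := hD0.trans_le hDκ; positivity
    have hηκ : η ≤ κ / 4 := by rw [hη]; nlinarith
    have hs : 0 < ‖ν‖ := norm_pos_iff.2 hν0
    rw [mem_ball, dist_eq_norm] at hw
    have hrad : (1 + 1 / 5 * η) * (‖ν‖ * σ) ≤ ‖ν‖ * (σ + 1 / 5 * η) := by
      nlinarith [mul_nonneg hη0 (sub_nonneg.2 hσ1), mul_nonneg hs.le
        (mul_nonneg hη0 (sub_nonneg.2 hσ1))]
    have hnorm : ‖w - ν - z‖ ≤ 3 * ‖ν‖ := by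
      calc ‖w - ν - z‖ = ‖(w - z) - ν‖ := by congr 1; abel
        _ ≤ ‖w - z‖ + ‖ν‖ := norm_sub_le _ _
        _ ≤ 3 * ‖ν‖ := by nlinarith
    have hwν : w - ν ∈ ball z (r / 2) := by
      rw [mem_ball, dist_eq_norm]; linarith
    have hmv := (convex_ball z (r / 2)).norm_image_sub_le_of_norm_fderiv_le'
      (f := u) (φ := -(c • yCoord)) (fun x hx => (hC2.contDiffAt (hΩo.mem_nhds
        (hball (ball_subset_ball (by linarith) hx)))).differentiableAt two_ne_zero)
      hgrad hzr hwν
    have hmv' := (le_abs_self _).trans hmv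
    have hφ : (-(c • yCoord)) (w - ν - z) = -c * (w - z) 1 + c * ν 1 := by
      simp; ring
    rw [hφ, hν1] at hmv'
    have hcoord : -(w - z) 1 ≤ ‖ν‖ * (σ + 1 / 5 * η) := by
      have h1 := PiLp.norm_apply_le (w - z) 1
      have h2 := neg_abs_le ((w - z) 1)
      rw [Real.norm_eq_abs] at h1
      linarith
    have h1 : c * (D / 100) * ‖w - ν - z‖ ≤ c * (D / 100) * (3 * ‖ν‖) := by gcongr
    have h2 := mul_le_mul_of_nonneg_left hcoord hc.le
    have h3 : 0 ≤ (Real.cos α - σ - 1 / 5 * η - 3 * (D / 100) - η) * (c * ‖ν‖) :=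
      mul_nonneg (by linarith) (by positivity)
    linarith

end
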